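/- Denoising score matching decomposition (Vincent's identity). Let p : ℝ^n → [0, ∞) be a Lebesgue-measurable probability density (∫ p dx = 1), σ > 0, φ_σ(u) := (2πσ²)^{−n/2}·exp(−‖u‖²/(2σ²)), and q_σ(y) := ∫ p(x)·φ_σ(y − x) dx. Let s : ℝ^n → ℝ^n be measurable with ∫ q_σ(y)·‖s(y)‖² dy < ∞, and assume ∫ q_σ(y)·‖∇ log q_σ(y)‖² dy < ∞. Then ∬ p(x)·φ_σ(y − x)·‖s(y) − (x − y)/σ²‖² dx dy = ∫ q_σ(y)·‖s(y) − ∇ log q_σ(y)‖² dy + C, where C := ∬ p(x)·φ_σ(y − x)·‖(x − y)/σ²‖² dx dy − ∫ q_σ(y)·‖∇ log q_σ(y)‖² dy does not depend on s (and the terms on both sides are finite). -/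

import Mathlib

open MeasureTheory

/-- The density of a centered Gaussian `N(0, σ² I)` on `ℝⁿ`. -/
noncomputable def gaussianKernel (n : ℕ) (σ : ℝ) (u : EuclideanSpace ℝ (Fin n)) : ℝ :=
  (2 * Real.pi * σ ^ 2) ^ (-(n : ℝ) / 2) * Real.exp (-‖u‖ ^ 2 / (2 * σ ^ 2))

/-- The Gaussian-smoothed density `q_σ = p * φ_σ`. -/
noncomputable def smoothedDensity (n : ℕ) (σ : ℝ) (p : EuclideanSpace ℝ (Fin n) → ℝ)
    (y : EuclideanSpace ℝ (Fin n)) : ℝ :=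
  ∫ x, p x * gaussianKernel n σ (y - x)

/-- The score `∇ log q_σ` of the Gaussian-smoothed density. -/
noncomputable def smoothedScore (n : ℕ) (σ : ℝ) (p : EuclideanSpace ℝ (Fin n) → ℝ)
    (y : EuclideanSpace ℝ (Fin n)) : EuclideanSpace ℝ (Fin n) :=
  gradient (fun y' => Real.log (smoothedDensity n σ p y')) y

section helpers

variable {n : ℕ} {σ : ℝ}

lemma gk_cont : Continuous (gaussianKernel n σ) := by
  unfold gaussianKernel
  fun_prop

lemma gk_pos (hσ : 0 < σ) (u : EuclideanSpace ℝ (Fin n)) : 0 < gaussianKernel n σ u := by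
  unfold gaussianKernel
  have := Real.pi_pos
  positivity

lemma integrable_gauss {b : ℝ} (hb : 0 < b) :
    Integrable (fun u : EuclideanSpace ℝ (Fin n) => Real.exp (-b * ‖u‖ ^ 2)) := by
  have h := (GaussianFourier.integrable_cexp_neg_mul_sq_norm_add (V := EuclideanSpace ℝ (Fin n)) (b := (b : ℂ))
    (by simpa using hb) 0 0).norm
  refine h.congr (Filter.Eventually.of_forall fun u => ?_)
  simp only [Complex.norm_exp]
  congr 1
  simp [← Complex.ofReal_pow, ← Complex.ofReal_mul, ← Complex.ofReal_neg]

lemma gk_eq (hσ : 0 < σ) (u : EuclideanSpace ℝ (Fin n)) : gaussianKernel n σ u =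
    (2 * Real.pi * σ ^ 2) ^ (-(n : ℝ) / 2) * Real.exp (-(1 / (2 * σ ^ 2)) * ‖u‖ ^ 2) := by
  unfold gaussianKernel
  congr 2
  field_simp

lemma exp_sq_bound {b : ℝ} (hb : 0 < b) (t : ℝ) :
    Real.exp (-b * t ^ 2) * t ^ 2 ≤ (2 / b) * Real.exp (-(b / 2) * t ^ 2) := by
  have h1 : b / 2 * t ^ 2 ≤ Real.exp (b / 2 * t ^ 2) := by
    linarith [Real.add_one_le_exp (b / 2 * t ^ 2)]
  have h2 : Real.exp (-(b / 2) * t ^ 2) = Real.exp (-b * t ^ 2) * Real.exp (b / 2 * t ^ 2) := by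
    rw [← Real.exp_add]; congr 1; ring
  rw [h2]
  have h3 : t ^ 2 = (2 / b) * (b / 2 * t ^ 2) := by field_simp
  calc Real.exp (-b * t ^ 2) * t ^ 2
      = (2 / b) * (Real.exp (-b * t ^ 2) * (b / 2 * t ^ 2)) := by
        field_simp
    _ ≤ _ := by gcongr

lemma gk_sq_le (hσ : 0 < σ) (u : EuclideanSpace ℝ (Fin n)) : gaussianKernel n σ u * ‖u‖ ^ 2 ≤
    (2 * Real.pi * σ ^ 2) ^ (-(n : ℝ) / 2) * ((2 / (1 / (2 * σ ^ 2))) *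
      Real.exp (-((1 / (2 * σ ^ 2)) / 2) * ‖u‖ ^ 2)) := by
  rw [gk_eq hσ, mul_assoc]
  have := Real.pi_pos
  refine mul_le_mul_of_nonneg_left (exp_sq_bound (by positivity) _) (by positivity)

lemma gk_sq_integrable (hσ : 0 < σ) :
    Integrable (fun u : EuclideanSpace ℝ (Fin n) => gaussianKernel n σ u * ‖u‖ ^ 2) := by
  have hb : 0 < (1 / (2 * σ ^ 2)) / 2 := by positivity
  refine (((integrable_gauss (n := n) hb).const_mul (2 / (1 / (2 * σ ^ 2)))).const_mul
    ((2 * Real.pi * σ ^ 2) ^ (-(n : ℝ) / 2))).mono'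
    ((gk_cont.mul (by fun_prop)).aestronglyMeasurable) (Filter.Eventually.of_forall fun u => ?_)
  rw [Real.norm_of_nonneg (mul_nonneg (gk_pos hσ u).le (by positivity))]
  exact gk_sq_le hσ u

lemma gk_bdd (hσ : 0 < σ) : ∃ C : ℝ, 0 ≤ C ∧ ∀ u : EuclideanSpace ℝ (Fin n), gaussianKernel n σ u ≤ C ∧
    gaussianKernel n σ u * ‖u‖ ≤ C ∧ gaussianKernel n σ u * ‖u‖ ^ 2 ≤ C := by
  have := Real.pi_pos
  set c : ℝ := (2 * Real.pi * σ ^ 2) ^ (-(n : ℝ) / 2) with hc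
  have hc0 : 0 ≤ c := by positivity
  set M : ℝ := c * (2 / (1 / (2 * σ ^ 2))) with hM
  have hM0 : 0 ≤ M := by positivity
  refine ⟨c + M, by positivity, fun u => ?_⟩
  have h1 : gaussianKernel n σ u ≤ c := by
    rw [gk_eq hσ]
    refine mul_le_of_le_one_right hc0 (Real.exp_le_one_iff.2 ?_)
    have : 0 ≤ 1 / (2 * σ ^ 2) * ‖u‖ ^ 2 := by positivity
    linarith
  have h2 : gaussianKernel n σ u * ‖u‖ ^ 2 ≤ M := by
    refine (gk_sq_le hσ u).trans ?_
    rw [hM, ← mul_assoc]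
    refine mul_le_of_le_one_right hM0 (Real.exp_le_one_iff.2 ?_)
    have : 0 ≤ 1 / (2 * σ ^ 2) / 2 * ‖u‖ ^ 2 := by positivity
    linarith
  have h0 := (gk_pos hσ u).le
  refine ⟨by linarith, ?_, by linarith⟩
  nlinarith [mul_nonneg h0 (sq_nonneg (‖u‖ - 1)), mul_nonneg h0 (sq_nonneg ‖u‖)]

lemma smul_integrable {F : Type*} [NormedAddCommGroup F] [NormedSpace ℝ F] {p : EuclideanSpace ℝ (Fin n) → ℝ}
    (hp : Integrable p) (g : EuclideanSpace ℝ (Fin n) → F) (hg : AEStronglyMeasurable g)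
    (C : ℝ) (hC : ∀ x, ‖g x‖ ≤ C) : Integrable (fun x => p x • g x) := by
  refine (hp.norm.mul_const C).mono' (hp.aestronglyMeasurable.smul hg)
    (Filter.Eventually.of_forall fun x => ?_)
  rw [norm_smul]
  gcongr
  exact hC x

/-- `p(x) φ(y-x)` is integrable in `x`. -/
lemma int0 (hσ : 0 < σ) {p : EuclideanSpace ℝ (Fin n) → ℝ} (hp : Integrable p) (y : EuclideanSpace ℝ (Fin n)) :
    Integrable (fun x => p x * gaussianKernel n σ (y - x)) := by
  obtain ⟨C, hC0, hC⟩ := gk_bdd (n := n) hσ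
  refine smul_integrable hp _ (Continuous.aestronglyMeasurable
    (gk_cont.comp (by fun_prop))) C fun x => ?_
  rw [Real.norm_of_nonneg (gk_pos hσ _).le]
  exact (hC _).1

lemma vec_bdd (hσ : 0 < σ) {C : ℝ} (hC : ∀ u : EuclideanSpace ℝ (Fin n), gaussianKernel n σ u * ‖u‖ ≤ C) (x y : EuclideanSpace ℝ (Fin n)) :
    ‖gaussianKernel n σ (y - x) • ((σ ^ 2)⁻¹ • (x - y))‖ ≤ (σ ^ 2)⁻¹ * C := by
  rw [norm_smul, norm_smul, Real.norm_of_nonneg (gk_pos hσ _).le,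
    Real.norm_of_nonneg (by positivity), norm_sub_rev x y, mul_left_comm]
  exact mul_le_mul_of_nonneg_left (hC _) (by positivity)

lemma vec_cont (y : EuclideanSpace ℝ (Fin n)) :
    Continuous (fun x : EuclideanSpace ℝ (Fin n) => gaussianKernel n σ (y - x) • ((σ ^ 2)⁻¹ • (x - y))) :=
  (gk_cont.comp (by fun_prop)).smul (by fun_prop)

lemma int1 (hσ : 0 < σ) {p : EuclideanSpace ℝ (Fin n) → ℝ} (hp : Integrable p) (y : EuclideanSpace ℝ (Fin n)) :
    Integrable (fun x => p x • (gaussianKernel n σ (y - x) • ((σ ^ 2)⁻¹ • (x - y)))) := by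
  obtain ⟨C, hC0, hC⟩ := gk_bdd (n := n) hσ
  exact smul_integrable hp _ (vec_cont y).aestronglyMeasurable _
    fun x => vec_bdd hσ (fun u => (hC u).2.1) x y

lemma int2 (hσ : 0 < σ) {p : EuclideanSpace ℝ (Fin n) → ℝ} (hp : Integrable p) (y : EuclideanSpace ℝ (Fin n)) :
    Integrable (fun x => p x * gaussianKernel n σ (y - x) * ‖(σ ^ 2)⁻¹ • (x - y)‖ ^ 2) := by
  obtain ⟨C, hC0, hC⟩ := gk_bdd (n := n) hσ
  have h := (smul_integrable hp (fun x => gaussianKernel n σ (y - x) * ‖y - x‖ ^ 2)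
    (Continuous.aestronglyMeasurable
      ((gk_cont.comp (by fun_prop)).mul (by fun_prop))) C fun x => by
      rw [Real.norm_of_nonneg (mul_nonneg (gk_pos hσ _).le (by positivity))]
      exact (hC _).2.2).const_mul (((σ ^ 2)⁻¹) ^ 2)
  refine h.congr (Filter.Eventually.of_forall fun x => ?_)
  simp only [smul_eq_mul, norm_smul, norm_sub_rev x y, mul_pow, Real.norm_eq_abs, sq_abs]
  ring

lemma T_int (hσ : 0 < σ) {p : EuclideanSpace ℝ (Fin n) → ℝ} (hp : Integrable p) :
    Integrable (fun y : EuclideanSpace ℝ (Fin n) =>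
      ∫ x, p x * gaussianKernel n σ (y - x) * ‖(σ ^ 2)⁻¹ • (x - y)‖ ^ 2) := by
  have h := Integrable.integrable_convolution (ContinuousLinearMap.mul ℝ ℝ) hp
    ((gk_sq_integrable (n := n) hσ).const_mul (((σ ^ 2)⁻¹) ^ 2))
  refine h.congr (Filter.Eventually.of_forall fun y => ?_)
  simp only [convolution_def, ContinuousLinearMap.mul_apply']
  congr 1
  ext x
  simp only [norm_smul, norm_sub_rev x y, mul_pow, Real.norm_eq_abs, sq_abs]
  ring

lemma q_pos (hσ : 0 < σ) {p : EuclideanSpace ℝ (Fin n) → ℝ} (hp : Integrable p) (hp0 : ∀ x, 0 ≤ p x)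
    (hp1 : ∫ x, p x = 1) (y : EuclideanSpace ℝ (Fin n)) : 0 < smoothedDensity n σ p y := by
  unfold smoothedDensity
  rw [integral_pos_iff_support_of_nonneg (fun x => mul_nonneg (hp0 x) (gk_pos hσ _).le)
    (int0 hσ hp y)]
  have h : 0 < ∫ x, p x := by rw [hp1]; exact one_pos
  rw [integral_pos_iff_support_of_nonneg hp0 hp] at h
  convert h using 2
  ext x
  simp [(gk_pos hσ (y - x)).ne']

lemma gk_deriv (hσ : 0 < σ) (x y : EuclideanSpace ℝ (Fin n)) :
    HasFDerivAt (fun y => gaussianKernel n σ (y - x))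
      (innerSL ℝ (gaussianKernel n σ (y - x) • ((σ ^ 2)⁻¹ • (x - y)))) y := by
  have h1 : HasFDerivAt (fun y : EuclideanSpace ℝ (Fin n) => ‖y - x‖ ^ 2) (2 • innerSL ℝ (y - x)) y := by
    have := ((hasStrictFDerivAt_norm_sq (y - x)).hasFDerivAt).comp y
      ((hasFDerivAt_id (𝕜 := ℝ) y).sub_const x)
    refine HasFDerivAt.congr_fderiv this ?_
    ext w
    simp
  have h2 := ((h1.const_mul (-(1 / (2 * σ ^ 2)))).exp).const_mul
    ((2 * Real.pi * σ ^ 2) ^ (-(n : ℝ) / 2))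
  simp only [← gk_eq hσ] at h2
  refine h2.congr_fderiv ?_
  ext w
  simp only [gk_eq hσ, innerSL_apply_apply, inner_smul_left, smul_apply,
    smul_eq_mul, nsmul_eq_mul, ← neg_sub y x, inner_neg_left]
  simp
  field_simp

lemma q_deriv (hσ : 0 < σ) {p : EuclideanSpace ℝ (Fin n) → ℝ} (hp : Integrable p) (y : EuclideanSpace ℝ (Fin n)) :
    HasGradientAt (smoothedDensity n σ p)
      (∫ x, p x • (gaussianKernel n σ (y - x) • ((σ ^ 2)⁻¹ • (x - y)))) y := by
  obtain ⟨C, hC0, hC⟩ := gk_bdd (n := n) hσ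
  have hm : ∀ y : EuclideanSpace ℝ (Fin n), AEStronglyMeasurable (fun x : EuclideanSpace ℝ (Fin n) => innerSL ℝ
      (gaussianKernel n σ (y - x) • ((σ ^ 2)⁻¹ • (x - y)))) :=
    fun y => ((innerSL ℝ).continuous.comp (vec_cont y)).aestronglyMeasurable
  have hb : ∀ x y : EuclideanSpace ℝ (Fin n), ‖innerSL ℝ
      (gaussianKernel n σ (y - x) • ((σ ^ 2)⁻¹ • (x - y)))‖ ≤ (σ ^ 2)⁻¹ * C := fun x y => by
    rw [innerSL_apply_norm]; exact vec_bdd hσ (fun u => (hC u).2.1) x y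
  have hi := smul_integrable hp _ (hm y) _ (fun x => hb x y)
  have h := hasFDerivAt_integral_of_dominated_of_fderiv_le (𝕜 := ℝ) (μ := volume)
    (s := Set.univ) (x₀ := y)
    (F := fun y x => p x * gaussianKernel n σ (y - x))
    (F' := fun y x => p x • innerSL ℝ
      (gaussianKernel n σ (y - x) • ((σ ^ 2)⁻¹ • (x - y))))
    (bound := fun x => ‖p x‖ * ((σ ^ 2)⁻¹ * C)) Filter.univ_mem
    (Filter.Eventually.of_forall fun y => (int0 hσ hp y).aestronglyMeasurable)
    (int0 hσ hp y) hi.aestronglyMeasurable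
    (Filter.Eventually.of_forall fun x y _ => by
      rw [norm_smul]; exact mul_le_mul_of_nonneg_left (hb x y) (norm_nonneg _))
    (hp.norm.mul_const _)
    (Filter.Eventually.of_forall fun x y _ => (gk_deriv hσ x y).const_mul (p x))
  rw [hasGradientAt_iff_hasFDerivAt]
  refine HasFDerivAt.congr_fderiv h ?_
  ext w
  rw [ContinuousLinearMap.integral_apply hi, InnerProductSpace.toDual_apply_apply,
    real_inner_comm, ← integral_inner (int1 hσ hp y)]
  congr 1
  ext x
  simp only [smul_apply, innerSL_apply_apply, inner_smul_right, smul_eq_mul,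
    real_inner_comm w]

lemma score_eq (hσ : 0 < σ) {p : EuclideanSpace ℝ (Fin n) → ℝ} (hp : Integrable p) (hp0 : ∀ x, 0 ≤ p x)
    (hp1 : ∫ x, p x = 1) (y : EuclideanSpace ℝ (Fin n)) : smoothedDensity n σ p y • smoothedScore n σ p y =
      ∫ x, p x • (gaussianKernel n σ (y - x) • ((σ ^ 2)⁻¹ • (x - y))) := by
  have hq := q_pos hσ hp hp0 hp1 y
  have h := (hasGradientAt_iff_hasFDerivAt.1 (q_deriv hσ hp y)).log hq.ne'
  have h2 : HasGradientAt (fun y' => Real.log (smoothedDensity n σ p y'))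
      ((smoothedDensity n σ p y)⁻¹ •
        ∫ x, p x • (gaussianKernel n σ (y - x) • ((σ ^ 2)⁻¹ • (x - y)))) y := by
    rw [hasGradientAt_iff_hasFDerivAt]
    refine h.congr_fderiv ?_
    simp
  unfold smoothedScore
  rw [h2.gradient, smul_inv_smul₀ hq.ne']

lemma pointwise (hσ : 0 < σ) {p : EuclideanSpace ℝ (Fin n) → ℝ} (hp : Integrable p) (hp0 : ∀ x, 0 ≤ p x)
    (hp1 : ∫ x, p x = 1) (y v : EuclideanSpace ℝ (Fin n)) :
    ∫ x, p x * gaussianKernel n σ (y - x) * ‖v - (σ ^ 2)⁻¹ • (x - y)‖ ^ 2 =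
      smoothedDensity n σ p y * ‖v - smoothedScore n σ p y‖ ^ 2 +
      ((∫ x, p x * gaussianKernel n σ (y - x) * ‖(σ ^ 2)⁻¹ • (x - y)‖ ^ 2) -
        smoothedDensity n σ p y * ‖smoothedScore n σ p y‖ ^ 2) := by
  have e : ∀ x, p x * gaussianKernel n σ (y - x) * ‖v - (σ ^ 2)⁻¹ • (x - y)‖ ^ 2 =
      p x * gaussianKernel n σ (y - x) * ‖v‖ ^ 2
      - 2 * inner ℝ v (p x • (gaussianKernel n σ (y - x) • ((σ ^ 2)⁻¹ • (x - y))))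
      + p x * gaussianKernel n σ (y - x) * ‖(σ ^ 2)⁻¹ • (x - y)‖ ^ 2 := fun x => by
    rw [norm_sub_sq_real, inner_smul_right v _ (p x),
      inner_smul_right v _ (gaussianKernel n σ (y - x))]
    ring
  have i0 := (int0 hσ hp y).mul_const (‖v‖ ^ 2)
  have i1 := ((int1 hσ hp y).const_inner v).const_mul (2 : ℝ)
  have i01 : Integrable (fun x => p x * gaussianKernel n σ (y - x) * ‖v‖ ^ 2 - 2 * inner ℝ v
      (p x • (gaussianKernel n σ (y - x) • ((σ ^ 2)⁻¹ • (x - y))))) := i0.sub i1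
  simp only [e]
  rw [integral_add i01 (int2 hσ hp y), integral_sub i0 i1, integral_mul_const,
    integral_const_mul, integral_inner (int1 hσ hp y), ← score_eq hσ hp hp0 hp1,
    norm_sub_sq_real, inner_smul_right]
  change smoothedDensity n σ p y * _ - _ + _ = _
  ring

end helpers

/-- Denoising score matching decomposition (Vincent's identity): for a probability
density `p` on `ℝⁿ`, noise level `σ > 0` and a candidate score `s` with
`∫ q_σ ‖s‖² < ∞` (and `∫ q_σ ‖∇ log q_σ‖² < ∞`), the denoising score matching objective
`∬ p(x) φ_σ(y-x) ‖s(y) - (x-y)/σ²‖² dx dy` equals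
`∫ q_σ(y) ‖s(y) - ∇ log q_σ(y)‖² dy + C`, where
`C = ∬ p(x) φ_σ(y-x) ‖(x-y)/σ²‖² dx dy - ∫ q_σ(y) ‖∇ log q_σ(y)‖² dy` does not depend
on `s`; moreover all terms involved are finite (integrable). -/
theorem denoising_score_matching_identity {n : ℕ}
    (p : EuclideanSpace ℝ (Fin n) → ℝ)
    (hpm : Measurable p) (hp0 : ∀ x, 0 ≤ p x)
    (hp1 : ∫ x, p x = 1)
    (σ : ℝ) (hσ : 0 < σ)
    (s : EuclideanSpace ℝ (Fin n) → EuclideanSpace ℝ (Fin n))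
    (hsm : Measurable s)
    (hs : Integrable (fun y => smoothedDensity n σ p y * ‖s y‖ ^ 2))
    (hscore : Integrable (fun y =>
        smoothedDensity n σ p y * ‖smoothedScore n σ p y‖ ^ 2)) :
    Integrable (fun y =>
        ∫ x, p x * gaussianKernel n σ (y - x) * ‖s y - (σ ^ 2)⁻¹ • (x - y)‖ ^ 2) ∧
    Integrable (fun y =>
        smoothedDensity n σ p y * ‖s y - smoothedScore n σ p y‖ ^ 2) ∧
    Integrable (fun y =>
        ∫ x, p x * gaussianKernel n σ (y - x) * ‖(σ ^ 2)⁻¹ • (x - y)‖ ^ 2) ∧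
    (∫ y, ∫ x, p x * gaussianKernel n σ (y - x) * ‖s y - (σ ^ 2)⁻¹ • (x - y)‖ ^ 2) =
      (∫ y, smoothedDensity n σ p y * ‖s y - smoothedScore n σ p y‖ ^ 2) +
      ((∫ y, ∫ x, p x * gaussianKernel n σ (y - x) * ‖(σ ^ 2)⁻¹ • (x - y)‖ ^ 2) -
        ∫ y, smoothedDensity n σ p y * ‖smoothedScore n σ p y‖ ^ 2) := by
  have hp : Integrable p := by
    by_contra h
    rw [integral_undef h] at hp1
    exact zero_ne_one hp1
  have hT := T_int hσ hp
  have hqm : Measurable (smoothedDensity n σ p) :=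
    (continuous_iff_continuousAt.2 fun y =>
      (hasGradientAt_iff_hasFDerivAt.1 (q_deriv hσ hp y)).continuousAt).measurable
  have hscm : Measurable (smoothedScore n σ p) := by
    unfold smoothedScore gradient
    exact (LinearIsometryEquiv.continuous _).measurable.comp (measurable_fderiv ℝ _)
  have hA : Integrable (fun y =>
      smoothedDensity n σ p y * ‖s y - smoothedScore n σ p y‖ ^ 2) := by
    refine ((hs.const_mul 2).add (hscore.const_mul 2)).mono'
      (hqm.mul ((hsm.sub hscm).norm.pow_const 2)).aestronglyMeasurable
      (Filter.Eventually.of_forall fun y => ?_)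
    have hq := (q_pos hσ hp hp0 hp1 y).le
    rw [Real.norm_of_nonneg (mul_nonneg hq (by positivity))]
    have h1 := parallelogram_law_with_norm ℝ (s y) (smoothedScore n σ p y)
    have h2 : ‖s y - smoothedScore n σ p y‖ ^ 2 ≤
        2 * ‖s y‖ ^ 2 + 2 * ‖smoothedScore n σ p y‖ ^ 2 := by
      nlinarith [mul_self_nonneg ‖s y + smoothedScore n σ p y‖]
    have h3 := mul_le_mul_of_nonneg_left h2 hq
    simp only [Pi.add_apply]
    linarith
  have hpt : (fun y => ∫ x, p x * gaussianKernel n σ (y - x) *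
      ‖s y - (σ ^ 2)⁻¹ • (x - y)‖ ^ 2) = _ :=
    funext fun y => pointwise hσ hp hp0 hp1 y (s y)
  refine ⟨?_, hA, hT, ?_⟩
  · rw [hpt]
    exact hA.add (hT.sub hscore)
  · have hTs : Integrable (fun y =>
        (∫ x, p x * gaussianKernel n σ (y - x) * ‖(σ ^ 2)⁻¹ • (x - y)‖ ^ 2) -
        smoothedDensity n σ p y * ‖smoothedScore n σ p y‖ ^ 2) := hT.sub hscore
    rw [hpt, integral_add hA hTs, integral_sub hT hscore]
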